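/- Let U ⊂ ℝⁿ be a connected open set and let u ∈ L¹_loc(U;ℝⁿ) have vanishing distributional symmetric gradient, i.e. for all i,j ∈ {1,…,n} and every smooth compactly supported φ: U → ℝ one has ∫_U (u_i(x) ∂_j φ(x) + u_j(x) ∂_i φ(x)) dx = 0. Then u is (almost everywhere equal to) a rigid displacement: there exist a skew-symmetric n×n matrix R and a vector c ∈ ℝⁿ such that u(x) = Rx + c for a.e. x ∈ U. -/

import Mathlib

open MeasureTheory

open Filter Topology Metric
open scoped RealInnerProductSpace

section RigidDisplacement

variable {E : Type*} [NormedAddCommGroup E] [InnerProductSpace ℝ E]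

/-- The continuous linear endomorphisms `A` with `⟪A x, x⟫ = 0` for all `x`. -/
def skewSubmodule (E : Type*) [NormedAddCommGroup E] [InnerProductSpace ℝ E] :
    Submodule ℝ (E →L[ℝ] E) where
  carrier := {A | ∀ x, ⟪A x, x⟫ = 0}
  add_mem' {A B} hA hB x := by
    simp only [Set.mem_ofPred_eq] at hA hB
    simp [inner_add_left, hA, hB]
  zero_mem' x := by simp
  smul_mem' a A hA x := by
    simp only [Set.mem_ofPred_eq] at hA
    simp [inner_smul_left, hA]

/-- A rigid displacement `x ↦ A x + c` with `A` skew. -/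
def IsRigidDisplacement (f : E → E) : Prop :=
  ∃ A ∈ skewSubmodule E, ∃ c, ∀ x, f x = A x + c

lemma inner_skew {A : E →L[ℝ] E} (hA : A ∈ skewSubmodule E) (x y : E) :
    ⟪A x, y⟫ = -⟪A y, x⟫ := by
  have hx : ⟪A x, x⟫ = 0 := hA x
  have hy : ⟪A y, y⟫ = 0 := hA y
  have h : ⟪A (x + y), x + y⟫ = 0 := hA (x + y)
  simp only [map_add, inner_add_left, inner_add_right, hx, hy] at h
  linarith

lemma IsRigidDisplacement.eq_of_eventuallyEq {f g : E → E} (hf : IsRigidDisplacement f)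
    (hg : IsRigidDisplacement g) {x : E} (h : f =ᶠ[𝓝 x] g) : f = g := by
  obtain ⟨A, -, c, hA⟩ := hf
  obtain ⟨B, -, d, hB⟩ := hg
  obtain rfl : f = fun x => A x + c := funext hA
  obtain rfl : g = fun x => B x + d := funext hB
  exact AnalyticOnNhd.eq_of_eventuallyEq (𝕜 := ℝ)
    (fun y _ => (A.analyticAt y).add analyticAt_const)
    (fun y _ => (B.analyticAt y).add analyticAt_const) h

lemma IsRigidDisplacement.continuous {f : E → E} (hf : IsRigidDisplacement f) :
    Continuous f := by
  obtain ⟨A, -, c, hA⟩ := hf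
  obtain rfl : f = fun x => A x + c := funext hA
  fun_prop

/-- On any set, a pointwise limit of rigid displacements is a rigid displacement. -/
lemma exists_isRigidDisplacement_of_tendsto [FiniteDimensional ℝ E] {ι : Type*} {l : Filter ι}
    [l.NeBot] {s : Set E} {F : ι → E → E} {f : E → E}
    (hF : ∀ᶠ k in l, ∃ g, IsRigidDisplacement g ∧ Set.EqOn (F k) g s)
    (hlim : ∀ x ∈ s, Tendsto (fun k => F k x) l (𝓝 (f x))) :
    ∃ g, IsRigidDisplacement g ∧ Set.EqOn f g s := by
  let T : ((E →L[ℝ] E) × E) →ₗ[ℝ] (s → E) :=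
    { toFun := fun p x => p.1 x + p.2
      map_add' := fun p q => by ext x; simp; abel
      map_smul' := fun a p => by ext x; simp }
  let K : Submodule ℝ (s → E) := ((skewSubmodule E).prod ⊤).map T
  have hK : IsClosed (K : Set (s → E)) := K.closed_of_finiteDimensional
  have hmem : (fun x : s => f x) ∈ K := by
    refine hK.mem_of_tendsto (f := fun k (x : s) => F k x)
      (tendsto_pi_nhds.2 fun x => hlim x x.2) ?_
    filter_upwards [hF] with k hk
    obtain ⟨g, ⟨A, hA, c, hg⟩, hFg⟩ := hk
    refine ⟨(A, c), ⟨hA, trivial⟩, ?_⟩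
    ext x
    simp [T, hFg x.2, hg]
  obtain ⟨⟨A, c⟩, ⟨hA, -⟩, h⟩ := hmem
  exact ⟨fun x => A x + c, ⟨A, hA, c, fun _ => rfl⟩, fun x hx => (congrFun h ⟨x, hx⟩).symm⟩

/-- A map `w` with `⟪w x - w y, x - y⟫ = 0` on a ball is a rigid displacement there. -/
lemma exists_isRigidDisplacement_of_inner_sub_eq_zero [FiniteDimensional ℝ E] {w : E → E}
    {x₀ : E} {r : ℝ} (hr : 0 < r)
    (h : ∀ x ∈ ball x₀ r, ∀ y ∈ ball x₀ r, ⟪w x - w y, x - y⟫ = 0) :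
    ∃ g, IsRigidDisplacement g ∧ Set.EqOn w g (ball x₀ r) := by
  let v : E → E := fun z => w (x₀ + z) - w x₀
  have mem : ∀ z : E, ‖z‖ < r → x₀ + z ∈ ball x₀ r := fun z hz => by simpa using hz
  have hdiag : ∀ z, ‖z‖ < r → ⟪v z, z⟫ = 0 := fun z hz => by
    simpa [v] using h _ (mem z hz) x₀ (mem_ball_self hr)
  have hskew : ∀ y z, ‖y‖ < r → ‖z‖ < r → ⟪v y, z⟫ = -⟪v z, y⟫ := fun y z hy hz => by
    have h1 := h _ (mem y hy) _ (mem z hz)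
    have h2 : ⟪v y - v z, y - z⟫ = 0 := by simpa [v] using h1
    simp only [inner_sub_left, inner_sub_right, hdiag y hy, hdiag z hz] at h2
    linarith
  let b := stdOrthonormalBasis ℝ E
  have hb : ∀ i, ‖(r / 2) • b i‖ < r := fun i => by
    rw [norm_smul, b.norm_eq_one, Real.norm_of_nonneg (by positivity)]
    linarith
  let A : E →L[ℝ] E :=
    ∑ i, (-(r / 2)⁻¹ • innerSL ℝ (v ((r / 2) • b i))).smulRight (b i)
  have hAv : ∀ z, ‖z‖ < r → A z = v z := fun z hz => by
    rw [← b.sum_repr' (v z)]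
    simp only [A, sum_apply, ContinuousLinearMap.smulRight_apply, smul_apply, innerSL_apply_apply, smul_eq_mul]
    refine Finset.sum_congr rfl fun i _ => ?_
    have h1 := hskew z _ hz (hb i)
    rw [inner_smul_right, real_inner_comm] at h1
    congr 1
    field_simp
    linarith
  have hA : A ∈ skewSubmodule E := fun z => by
    obtain ⟨t, ht, htz⟩ : ∃ t : ℝ, 0 < t ∧ ‖t • z‖ < r := by
      refine ⟨r / (‖z‖ + 1), by positivity, ?_⟩
      rw [norm_smul, Real.norm_of_nonneg (by positivity), div_mul_eq_mul_div,
        div_lt_iff₀ (by positivity)]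
      nlinarith
    have h1 := hdiag _ htz
    rw [← hAv _ htz, map_smul, inner_smul_left, inner_smul_right] at h1
    simpa [ht.ne'] using h1
  refine ⟨fun x => A x + (w x₀ - A x₀), ⟨A, hA, _, fun _ => rfl⟩, fun x hx => ?_⟩
  have h1 := hAv (x - x₀) (by simpa [dist_eq_norm] using hx)
  simp only [v, map_sub, add_sub_cancel] at h1
  change w x = A x + (w x₀ - A x₀)
  rw [eq_sub_iff_add_eq] at h1
  rw [← h1]
  abel

lemma exists_isRigidDisplacement_of_fderiv_skew [FiniteDimensional ℝ E] {w : E → E}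
    {w' : E → E →L[ℝ] E} {x₀ : E} {r : ℝ} (hr : 0 < r)
    (hw : ∀ x ∈ ball x₀ r, HasFDerivAt w (w' x) x)
    (hskew : ∀ x ∈ ball x₀ r, w' x ∈ skewSubmodule E) :
    ∃ g, IsRigidDisplacement g ∧ Set.EqOn w g (ball x₀ r) := by
  refine exists_isRigidDisplacement_of_inner_sub_eq_zero hr fun x hx y hy => ?_
  let γ : ℝ → ℝ := fun t => ⟪w (y + t • (x - y)), x - y⟫
  have hmem : ∀ t ∈ Set.Icc (0 : ℝ) 1, y + t • (x - y) ∈ ball x₀ r := fun t ht =>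
    (convex_ball x₀ r).add_smul_sub_mem hy hx ht
  have hγ : ∀ t ∈ Set.Icc (0 : ℝ) 1, HasDerivAt γ 0 t := fun t ht => by
    have h1 : HasDerivAt (fun t : ℝ => y + t • (x - y)) (x - y) t := by
      simpa using ((hasDerivAt_id t).smul_const (x - y)).const_add y
    have h2 := ((hw _ (hmem t ht)).comp_hasDerivAt t h1).inner ℝ (hasDerivAt_const t (x - y))
    have h3 : ⟪w' (y + t • (x - y)) (x - y), x - y⟫ = 0 := hskew _ (hmem t ht) (x - y)
    simpa only [h3, inner_zero_right, zero_add, Function.comp_apply] using h2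
  have := constant_of_has_deriv_right_zero (fun t ht => (hγ t ht).continuousAt.continuousWithinAt)
    (fun t ht => (hγ t ⟨ht.1, ht.2.le⟩).hasDerivWithinAt) 1 ⟨zero_le_one, le_rfl⟩
  simp only [γ, one_smul, zero_smul, add_zero, add_sub_cancel] at this
  rw [inner_sub_left, this, sub_self]

/-- A function which is locally a.e. equal to rigid displacements on a preconnected open set is
a.e. equal to a single one. -/
lemma exists_isRigidDisplacement_of_locally [FiniteDimensional ℝ E] [MeasurableSpace E]
    [BorelSpace E] {μ : Measure E} [μ.IsOpenPosMeasure] {U : Set E} (hU : IsOpen U)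
    (hUconn : IsConnected U) {u : E → E}
    (h : ∀ x ∈ U, ∃ g, IsRigidDisplacement g ∧ ∃ r > 0, ∀ᵐ y ∂μ, y ∈ ball x r → u y = g y) :
    ∃ g, IsRigidDisplacement g ∧ ∀ᵐ y ∂μ.restrict U, u y = g y := by
  choose! g hg r hr hug using h
  have hconst : ∀ {x y}, x ∈ U → y ∈ U → g x = g y := by
    refine hUconn.isPreconnected.induction₂ (fun x y => g x = g y) (fun x hx => ?_)
      (fun _ _ _ _ _ _ => Eq.trans) (fun _ _ _ _ => Eq.symm)
    filter_upwards [self_mem_nhdsWithin, mem_nhdsWithin_of_mem_nhds (ball_mem_nhds x (hr x hx))]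
      with y hy hyx
    have hopen : IsOpen (ball x (r x) ∩ ball y (r y)) := isOpen_ball.inter isOpen_ball
    have hae : g x =ᵐ[μ.restrict (ball x (r x) ∩ ball y (r y))] g y := by
      refine (ae_restrict_iff' hopen.measurableSet).2 ?_
      filter_upwards [hug x hx, hug y hy] with z hzx hzy hz
      rw [← hzx hz.1, ← hzy hz.2]
    have heq := Measure.eqOn_open_of_ae_eq hae hopen (hg x hx).continuous.continuousOn
      (hg y hy).continuous.continuousOn
    exact (hg x hx).eq_of_eventuallyEq (hg y hy)
      (heq.eventuallyEq_of_mem (hopen.mem_nhds ⟨hyx, mem_ball_self (hr y hy)⟩))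
  obtain ⟨x₀, hx₀⟩ := hUconn.nonempty
  refine ⟨g x₀, hg x₀ hx₀, (ae_restrict_iff' hU.measurableSet).2 ?_⟩
  rw [ae_iff]
  refine measure_null_of_locally_null _ fun x hx => ?_
  have hxU : x ∈ U := by
    by_contra hxU
    exact hx fun h => absurd h hxU
  refine ⟨ball x (r x) ∩ {y | ¬(y ∈ U → u y = g x₀ y)},
    inter_mem (mem_nhdsWithin_of_mem_nhds (ball_mem_nhds x (hr x hxU))) self_mem_nhdsWithin, ?_⟩
  refine measure_mono_null ?_ (ae_iff.1 (hug x hxU))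
  intro y hy hyu
  exact hy.2 fun _ => (hyu hy.1).trans (congrFun (hconst hxU hx₀) y)

end RigidDisplacement

/-- An operator whose symmetric part vanishes in the standard basis is skew. -/
lemma mem_skewSubmodule_of_basis {n : ℕ}
    {A : EuclideanSpace ℝ (Fin n) →L[ℝ] EuclideanSpace ℝ (Fin n)}
    (hA : ∀ i j, A (EuclideanSpace.single j 1) i + A (EuclideanSpace.single i 1) j = 0) :
    A ∈ skewSubmodule (EuclideanSpace ℝ (Fin n)) := fun x => by
  have hx : A x = ∑ j, x j • A (EuclideanSpace.single j 1) := by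
    conv_lhs => rw [← (EuclideanSpace.basisFun (Fin n) ℝ).sum_repr x]
    simp
  have h1 : ⟪A x, x⟫ = ∑ i, ∑ j, x i * x j * A (EuclideanSpace.single j 1) i := by
    rw [hx, PiLp.inner_apply]
    refine Finset.sum_congr rfl fun i _ => ?_
    simp only [WithLp.ofLp_sum, WithLp.ofLp_smul, Finset.sum_apply, Pi.smul_apply, smul_eq_mul,
      RCLike.inner_apply, conj_trivial, Finset.mul_sum]
    exact Finset.sum_congr rfl fun j _ => by ring
  have h2 : ⟪A x, x⟫ = ∑ i, ∑ j, x j * x i * A (EuclideanSpace.single i 1) j := by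
    rw [h1, Finset.sum_comm]
  have h3 : ⟪A x, x⟫ + ⟪A x, x⟫ = 0 := by
    nth_rewrite 1 [h1]
    rw [h2, ← Finset.sum_add_distrib]
    refine Finset.sum_eq_zero fun i _ => ?_
    rw [← Finset.sum_add_distrib]
    refine Finset.sum_eq_zero fun j _ => ?_
    linear_combination x i * x j * hA i j
  linarith

/-- Mollifications of a field with vanishing distributional symmetric gradient are rigid
displacements on small balls. -/
lemma exists_isRigidDisplacement_convolution {n : ℕ} {U : Set (EuclideanSpace ℝ (Fin n))}
    {u : EuclideanSpace ℝ (Fin n) → EuclideanSpace ℝ (Fin n)}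
    (hsym : ∀ i j : Fin n, ∀ φ : EuclideanSpace ℝ (Fin n) → ℝ,
      ContDiff ℝ (⊤ : ℕ∞) φ → HasCompactSupport φ → tsupport φ ⊆ U →
      ∫ x in U, (u x i * fderiv ℝ φ x (EuclideanSpace.single j (1 : ℝ))
        + u x j * fderiv ℝ φ x (EuclideanSpace.single i (1 : ℝ))) = 0)
    {x₀ : EuclideanSpace ℝ (Fin n)} {r : ℝ} (hr : 0 < r) {s : Set (EuclideanSpace ℝ (Fin n))}
    (hsU : s ⊆ U) (hs : closedBall x₀ (2 * r) ⊆ s)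
    (hu : LocallyIntegrable (s.indicator u))
    {φ : EuclideanSpace ℝ (Fin n) → ℝ} (hφ : ContDiff ℝ (⊤ : ℕ∞) φ)
    (hφr : tsupport φ ⊆ closedBall 0 r) :
    ∃ g, IsRigidDisplacement g ∧
      Set.EqOn (convolution φ (s.indicator u) (ContinuousLinearMap.lsmul ℝ ℝ) volume) g
        (ball x₀ r) := by
  have hφc : HasCompactSupport φ :=
    (isCompact_closedBall _ _).of_isClosed_subset (isClosed_tsupport _) hφr
  have hφ1 : ContDiff ℝ 1 φ := hφ.of_le (by exact_mod_cast le_top)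
  have hdc : Continuous (fderiv ℝ φ) := hφ1.continuous_fderiv one_ne_zero
  rw [← convolution_flip]
  set L := (ContinuousLinearMap.lsmul ℝ ℝ :
    ℝ →L[ℝ] EuclideanSpace ℝ (Fin n) →L[ℝ] EuclideanSpace ℝ (Fin n)).flip with hL
  refine exists_isRigidDisplacement_of_fderiv_skew hr
    (fun x _ => hφc.hasFDerivAt_convolution_right L hu hφ1 x)
    (fun x hx => mem_skewSubmodule_of_basis fun i j => ?_)
  have hint : ∀ a, Integrable fun t => fderiv ℝ φ (x - t) a • s.indicator u t := fun a => by
    have h1 : HasCompactSupport fun y => fderiv ℝ φ y a := hφc.fderiv_apply ℝ a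
    exact h1.convolutionExists_right L hu (by fun_prop) x
  have happly : ∀ a (k : Fin n),
      (convolution (s.indicator u) (fderiv ℝ φ)
        (L.precompR (EuclideanSpace ℝ (Fin n))) volume x) a k
        = ∫ t, fderiv ℝ φ (x - t) a * s.indicator u t k := fun a k => by
    rw [convolution_precompR_apply L hu (hφc.fderiv ℝ) hdc x a, convolution_def]
    have := (EuclideanSpace.proj k : EuclideanSpace ℝ (Fin n) →L[ℝ] ℝ).integral_comp_comm (hint a)
    simpa [hL] using this.symm
  have hintk : ∀ a (k : Fin n), Integrable fun t => fderiv ℝ φ (x - t) a * s.indicator u t k :=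
    fun a k => by
      simpa using
        (EuclideanSpace.proj k : EuclideanSpace ℝ (Fin n) →L[ℝ] ℝ).integrable_comp (hint a)
  rw [happly, happly, ← integral_add (hintk _ _) (hintk _ _)]
  let ψ : EuclideanSpace ℝ (Fin n) → ℝ := fun t => φ (x - t)
  have hψs : tsupport ψ ⊆ s := by
    refine subset_trans ?_ hs
    refine closure_minimal (fun t ht => ?_) isClosed_closedBall
    have h1 : x - t ∈ closedBall 0 r := hφr (subset_tsupport _ ht)
    rw [mem_closedBall_zero_iff] at h1
    rw [mem_ball] at hx
    rw [mem_closedBall]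
    have h2 := dist_triangle t x x₀
    rw [dist_comm t x, dist_eq_norm x t] at h2
    linarith
  have hψ : ContDiff ℝ (⊤ : ℕ∞) ψ := hφ.comp (contDiff_const.sub contDiff_id)
  have hψc : HasCompactSupport ψ := hφc.comp_homeomorph (Homeomorph.subLeft x)
  have hdψ : ∀ t a, fderiv ℝ ψ t a = -fderiv ℝ φ (x - t) a := fun t a => by
    have h1 := ((hφ1.differentiable one_ne_zero (x - t)).hasFDerivAt).comp t
      ((hasFDerivAt_id t).const_sub x)
    have h2 : fderiv ℝ ψ t = _ := h1.fderiv
    rw [h2]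
    simp
  have hzero : ∀ t, t ∉ s → ∀ a, fderiv ℝ ψ t a = 0 := fun t ht a => by
    have h1 : fderiv ℝ ψ t = 0 :=
      image_eq_zero_of_notMem_tsupport fun h => ht (hψs (tsupport_fderiv_subset ℝ h))
    simp [h1]
  have h0 := hsym i j ψ hψ hψc (hψs.trans hsU)
  rw [setIntegral_eq_integral_of_forall_compl_eq_zero fun t ht => by
    simp [hzero t (fun h => ht (hsU h))]] at h0
  rw [← neg_eq_zero, ← integral_neg, ← h0]
  congr 1
  ext t
  by_cases ht : t ∈ s
  · simp only [hdψ, Set.indicator_of_mem ht]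
    ring
  · have h1 := hzero t ht
    simp [h1, Set.indicator_of_notMem ht]

/-- If `u ∈ L¹_loc(U;ℝⁿ)` on a connected open set `U ⊂ ℝⁿ` has vanishing
distributional symmetric gradient, then `u` is a.e. equal to a rigid displacement
`x ↦ Rx + c` with `R` skew-symmetric. -/
theorem rigid_of_vanishing_symmetric_gradient
    (n : ℕ) (U : Set (EuclideanSpace ℝ (Fin n))) (hU : IsOpen U) (hUconn : IsConnected U)
    (u : EuclideanSpace ℝ (Fin n) → EuclideanSpace ℝ (Fin n))
    (hu : LocallyIntegrableOn u U volume)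
    (hsym : ∀ i j : Fin n, ∀ φ : EuclideanSpace ℝ (Fin n) → ℝ,
      ContDiff ℝ (⊤ : ℕ∞) φ → HasCompactSupport φ → tsupport φ ⊆ U →
      ∫ x in U, (u x i * fderiv ℝ φ x (EuclideanSpace.single j (1 : ℝ))
        + u x j * fderiv ℝ φ x (EuclideanSpace.single i (1 : ℝ))) = 0) :
    ∃ (R : Matrix (Fin n) (Fin n) ℝ) (c : EuclideanSpace ℝ (Fin n)),
      R.transpose = -R ∧
      ∀ᵐ x ∂(volume.restrict U), ∀ i : Fin n, u x i = (∑ j : Fin n, R i j * x j) + c i := by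
  have hlocal : ∀ x ∈ U, ∃ g, IsRigidDisplacement g ∧
      ∃ r > 0, ∀ᵐ y, y ∈ ball x r → u y = g y := by
    intro x₀ hx₀
    obtain ⟨ρ, hρ, hρU⟩ := nhds_basis_closedBall.mem_iff.1 (hU.mem_nhds hx₀)
    have hr : 0 < ρ / 2 := by positivity
    have hv : LocallyIntegrable ((closedBall x₀ ρ).indicator u) :=
      ((hu.integrableOn_compact_subset hρU (isCompact_closedBall _ _)).integrable_indicator
        isClosed_closedBall.measurableSet).locallyIntegrable
    let δ : ℕ → ℝ := fun k => 1 / ((k : ℝ) + 1)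
    have hδ : ∀ k, 0 < δ k := fun k => by positivity
    let φ : ℕ → ContDiffBump (0 : EuclideanSpace ℝ (Fin n)) := fun k =>
      ⟨δ k / 2, δ k, half_pos (hδ k), half_lt_self (hδ k)⟩
    have hφ : Tendsto (fun k => (φ k).rOut) atTop (𝓝 0) := tendsto_one_div_add_atTop_nhds_zero_nat
    have hae := ContDiffBump.ae_convolution_tendsto_right_of_locallyIntegrable (K := 2) hφ
      (Eventually.of_forall fun k => by simp only [φ]; linarith) hv
    obtain ⟨g, hg, hug⟩ := exists_isRigidDisplacement_of_tendsto (l := atTop)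
      (s := ball x₀ (ρ / 2) ∩ {x | Tendsto (fun k => convolution ((φ k).normed volume)
        ((closedBall x₀ ρ).indicator u) (ContinuousLinearMap.lsmul ℝ ℝ) volume x) atTop
        (𝓝 ((closedBall x₀ ρ).indicator u x))})
      (F := fun k => convolution ((φ k).normed volume)
        ((closedBall x₀ ρ).indicator u) (ContinuousLinearMap.lsmul ℝ ℝ) volume)
      (f := (closedBall x₀ ρ).indicator u) (by
        filter_upwards [hφ.eventually_le_const hr] with k hk
        obtain ⟨g, hg, h⟩ := exists_isRigidDisplacement_convolution hsym hr hρU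
          (by rw [mul_div_cancel₀ _ two_ne_zero]) hv (φ k).contDiff_normed
          ((φ k).tsupport_normed_eq (μ := volume) |>.trans_subset (closedBall_subset_closedBall hk))
        exact ⟨g, hg, h.mono Set.inter_subset_left⟩)
      (fun x hx => hx.2)
    refine ⟨g, hg, ρ / 2, hr, ?_⟩
    filter_upwards [hae] with y hy hyb
    rw [← hug ⟨hyb, hy⟩, Set.indicator_of_mem]
    exact ball_subset_closedBall (ball_subset_ball (by linarith) hyb)
  obtain ⟨g, ⟨A, hA, c, hg⟩, hug⟩ := exists_isRigidDisplacement_of_locally hU hUconn hlocal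
  refine ⟨Matrix.of fun i j => A (EuclideanSpace.single j 1) i, c, ?_, ?_⟩
  · ext i j
    have := inner_skew hA (EuclideanSpace.single i 1) (EuclideanSpace.single j 1)
    simpa [EuclideanSpace.inner_single_right] using this
  · filter_upwards [hug] with x hx i
    have h : A x = ∑ j, x j • A (EuclideanSpace.single j 1) := by
      conv_lhs => rw [← (EuclideanSpace.basisFun (Fin n) ℝ).sum_repr x]
      simp
    rw [hx, hg, h]
    simp [mul_comm]
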